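/- arXiv:1904.10848 — 2 statements merged into one kernel-verified Lean document; each statement's English description precedes it below -/
import Mathlib

section
/- Let V₈ = ℂ⁸ with standard basis v₁,…,v₈ and let η₆ := v₄∧v₅∧v₆ + v₁∧v₄∧v₇ + v₂∧v₅∧v₇ + v₂∧v₆∧v₈ + v₃∧v₅∧v₈ ∈ ⋀³V₈. Then there is exactly one flag of subspaces V₁ ⊆ V₃ ⊆ V₄ ⊆ V₆ ⊆ V₇ ⊆ V₈ with dimensions 1, 3, 4, 6, 7 such that η₆ ∈ V₁∧V₄∧V₈ + V₁∧⋀²V₆ + ⋀²V₃∧V₇ + V₃∧V₄∧V₆, namely V₁ = span{v₈}, V₃ = span{v₄,v₇,v₈}, V₄ = span{v₄,v₅,v₇,v₈}, V₆ = span{v₂,v₄,v₅,v₆,v₇,v₈}, V₇ = span{v₁,v₂,v₄,v₅,v₆,v₇,v₈}. -/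
open ExteriorAlgebra

noncomputable section

/-- `V₈ = ℂ⁸`. -/
abbrev V8 : Type := Fin 8 → ℂ

/-- The standard basis vectors of `ℂ⁸`; `v i` corresponds to `v_{i+1}` of the paper. -/
def v (i : Fin 8) : V8 := Pi.single i 1

/-- For subspaces `S, T, U` of `W = ℂ⁸`, the subspace `S∧T∧U` of `⋀³W`, realized as the span,
inside the exterior algebra, of all products `s∧t∧u` with `s ∈ S`, `t ∈ T`, `u ∈ U`.
In particular `wSpan S T ⊤ = S∧T∧V₈`, `wSpan S T T = S∧⋀²T` and `wSpan S S T = ⋀²S∧T`. -/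
def wSpan (S T U : Submodule ℂ V8) : Submodule ℂ (ExteriorAlgebra ℂ V8) :=
  Submodule.span ℂ {x | ∃ s ∈ S, ∃ t ∈ T, ∃ u ∈ U, x = ι ℂ s * ι ℂ t * ι ℂ u}

/-- The representative `η₆ = v₄∧v₅∧v₆ + v₁∧v₄∧v₇ + v₂∧v₅∧v₇ + v₂∧v₆∧v₈ + v₃∧v₅∧v₈`
of the open orbit of the orbit closure `Y₆ ⊂ ⋀³ℂ⁸` (with 0-based indices). -/
def η6 : ExteriorAlgebra ℂ V8 :=
  ι ℂ (v 3) * ι ℂ (v 4) * ι ℂ (v 5) + ι ℂ (v 0) * ι ℂ (v 3) * ι ℂ (v 6) +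
  ι ℂ (v 1) * ι ℂ (v 4) * ι ℂ (v 6) + ι ℂ (v 1) * ι ℂ (v 5) * ι ℂ (v 7) +
  ι ℂ (v 2) * ι ℂ (v 4) * ι ℂ (v 7)

theorem v_apply (i j : Fin 8) : v i j = if j = i then 1 else 0 :=
  Pi.single_apply i 1 j

theorem span_v_le_of_forall {S : Set (Fin 8)} {p : Submodule ℂ V8} :
    Submodule.span ℂ (v '' S) ≤ p ↔ ∀ i ∈ S, v i ∈ p := by
  rw [Submodule.span_le, Set.image_subset_iff]; rfl

theorem mem_span_v_image {S : Set (Fin 8)} {u : V8} (h : ∀ i, i ∉ S → u i = 0) :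
    u ∈ Submodule.span ℂ (v '' S) := by
  rw [pi_eq_sum_univ' u]
  refine Submodule.sum_mem _ fun i _ ↦ ?_
  by_cases hi : i ∈ S
  · refine Submodule.smul_mem _ _ (Submodule.subset_span ⟨i, hi, ?_⟩)
    ext j
    simp [v_apply, Pi.single_apply]
  · simp [h i hi]

theorem apply_eq_zero_of_mem_span_v_image {S : Set (Fin 8)} {u : V8}
    (hu : u ∈ Submodule.span ℂ (v '' S)) {i : Fin 8} (hi : i ∉ S) : u i = 0 := by
  have h : Submodule.span ℂ (v '' S) ≤ LinearMap.ker (LinearMap.proj i : V8 →ₗ[ℂ] ℂ) :=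
    span_v_le_of_forall.mpr fun j hj ↦ by
      simp [v_apply, show i ≠ j from fun h ↦ hi (h ▸ hj)]
  exact h hu

theorem linearIndependent_v : LinearIndependent ℂ v := by
  have h : v = Pi.basisFun ℂ (Fin 8) := by
    ext i
    simp [v]
  rw [h]
  exact (Pi.basisFun ℂ (Fin 8)).linearIndependent

theorem finrank_span_v_image (S : Finset (Fin 8)) :
    Module.finrank ℂ (Submodule.span ℂ (v '' (S : Set (Fin 8)))) = S.card := by
  have h := finrank_span_eq_card
    (linearIndependent_v.comp (fun x : S ↦ (x : Fin 8)) Subtype.val_injective)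
  rwa [Set.range_comp, Subtype.range_coe_subtype, Fintype.card_coe] at h

/-- Contraction of a trivector with two linear forms, giving a vector. -/
def contract₂ (α β : Module.Dual ℂ V8) : ExteriorAlgebra ℂ V8 →ₗ[ℂ] V8 :=
  ExteriorAlgebra.ιInv ∘ₗ CliffordAlgebra.contractLeft β ∘ₗ CliffordAlgebra.contractLeft α

theorem contract₂_ι_mul_ι_mul_ι (α β : Module.Dual ℂ V8) (s t u : V8) :
    contract₂ α β (ι ℂ s * ι ℂ t * ι ℂ u) =
      (α s * β t - α t * β s) • u + (α t * β u - α u * β t) • s +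
        (α u * β s - α s * β u) • t := by
  have key : CliffordAlgebra.contractLeft β (CliffordAlgebra.contractLeft α
      (ι ℂ s * ι ℂ t * ι ℂ u)) = ι ℂ ((α s * β t - α t * β s) • u +
        (α t * β u - α u * β t) • s + (α u * β s - α s * β u) • t) := by
    rw [mul_assoc]
    simp only [ι, CliffordAlgebra.contractLeft_ι_mul, CliffordAlgebra.contractLeft_ι, map_sub,
      map_add, map_smul, Algebra.algebraMap_eq_smul_one, mul_smul_comm, mul_one, mul_sub,
      smul_sub]
    module
  have : contract₂ α β (ι ℂ s * ι ℂ t * ι ℂ u) = ExteriorAlgebra.ιInv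
    (CliffordAlgebra.contractLeft β (CliffordAlgebra.contractLeft α (ι ℂ s * ι ℂ t * ι ℂ u))) := rfl
  rw [this, key, ExteriorAlgebra.ι_leftInverse]

theorem contract₂_η6 (α β : Module.Dual ℂ V8) :
    contract₂ α β η6 =
    ![α (v 3) * β (v 6) - α (v 6) * β (v 3),
      α (v 4) * β (v 6) - α (v 6) * β (v 4) + α (v 5) * β (v 7) - α (v 7) * β (v 5),
      α (v 4) * β (v 7) - α (v 7) * β (v 4),
      α (v 4) * β (v 5) - α (v 5) * β (v 4) + α (v 6) * β (v 0) - α (v 0) * β (v 6),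
      α (v 5) * β (v 3) - α (v 3) * β (v 5) + α (v 6) * β (v 1) - α (v 1) * β (v 6) +
        α (v 7) * β (v 2) - α (v 2) * β (v 7),
      α (v 3) * β (v 4) - α (v 4) * β (v 3) + α (v 7) * β (v 1) - α (v 1) * β (v 7),
      α (v 0) * β (v 3) - α (v 3) * β (v 0) + α (v 1) * β (v 4) - α (v 4) * β (v 1),
      α (v 1) * β (v 5) - α (v 5) * β (v 1) + α (v 2) * β (v 4) - α (v 4) * β (v 2)] := by
  simp only [η6, map_add, contract₂_ι_mul_ι_mul_ι]
  ext i
  fin_cases i <;> simp [v_apply] <;> ring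

theorem minor_eq_zero {U : Submodule ℂ V8} (hU : Module.finrank ℂ U = 4) {p q : Fin 8}
    (hpq : p ≠ q) (hp : v p ∈ U) (hq : v q ∈ U) {r s t : V8} (hr : r ∈ U) (hs : s ∈ U)
    (ht : t ∈ U) {i j k : Fin 8} (hi : i ≠ p ∧ i ≠ q) (hj : j ≠ p ∧ j ≠ q) (hk : k ≠ p ∧ k ≠ q) :
    r i * (s j * t k - s k * t j) - r j * (s i * t k - s k * t i) +
      r k * (s i * t j - s j * t i) = 0 := by
  let f : Fin 5 → U := ![⟨v p, hp⟩, ⟨v q, hq⟩, ⟨r, hr⟩, ⟨s, hs⟩, ⟨t, ht⟩]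
  have hf : ¬ LinearIndependent ℂ f := fun h ↦ by
    have := h.fintype_card_le_finrank
    simp [hU] at this
  obtain ⟨g, hg, a, ha⟩ := Fintype.not_linearIndependent_iff.mp hf
  let c : Fin 5 → Fin 8 := ![p, q, i, j, k]
  have hdet : (Matrix.of fun a b ↦ (f a : V8) (c b)).det = 0 := by
    refine Matrix.exists_vecMul_eq_zero_iff.mp ⟨g, fun h ↦ ha (congrFun h a), ?_⟩
    ext b
    have := congrFun (congrArg Subtype.val hg) (c b)
    simpa [Matrix.vecMul, dotProduct] using this
  simp [Matrix.det_succ_row_zero, Fin.sum_univ_succ, f, c, v_apply, hpq, hpq.symm,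
    hi, hj, hk, Fin.succAbove] at hdet
  linear_combination hdet

theorem contract₂_mem_of_mem {α β : Module.Dual ℂ V8} {p S T U : Submodule ℂ V8}
    (h : ∀ s ∈ S, ∀ t ∈ T, ∀ u ∈ U, (α s * β t - α t * β s) • u +
      (α t * β u - α u * β t) • s + (α u * β s - α s * β u) • t ∈ p) :
    wSpan S T U ≤ p.comap (contract₂ α β) := by
  refine Submodule.span_le.mpr ?_
  rintro _ ⟨s, hs, t, ht, u, hu, rfl⟩
  simpa [contract₂_ι_mul_ι_mul_ι] using h s hs t ht u hu

theorem contract₂_η6_proj_swap (φ : Module.Dual ℂ V8) (j k : Fin 8) :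
    contract₂ φ (LinearMap.proj j) η6 k = -contract₂ φ (LinearMap.proj k) η6 j := by
  rw [contract₂_η6, contract₂_η6]
  fin_cases j <;> fin_cases k <;> simp [v_apply]

theorem exists_wedge_of_contract₂_mem {e : V8} (he : e ≠ 0) {φ : Module.Dual ℂ V8}
    (h : ∀ β : Module.Dual ℂ V8, β e = 0 → contract₂ φ β η6 ∈ Submodule.span ℂ {e}) :
    ∃ w : V8, ∀ j k, contract₂ φ (LinearMap.proj j) η6 k = e j * w k - e k * w j := by
  obtain ⟨i, hi⟩ := Function.ne_iff.mp he
  simp only [Pi.zero_apply] at hi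
  have hadd (j : Fin 8) : contract₂ φ (e i • LinearMap.proj j - e j • LinearMap.proj i) η6 =
      e i • contract₂ φ (LinearMap.proj j) η6 - e j • contract₂ φ (LinearMap.proj i) η6 := by
    simp [contract₂]
  refine ⟨fun k ↦ contract₂ φ (LinearMap.proj i) η6 k / e i, fun j k ↦ ?_⟩
  obtain ⟨c, hc⟩ := Submodule.mem_span_singleton.mp
    (h (e i • LinearMap.proj j - e j • LinearMap.proj i) (by simp [mul_comm]))
  rw [hadd] at hc
  have hk := congrFun hc k
  have hi' := congrFun hc i
  have hii := contract₂_η6_proj_swap φ i i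
  have hij := contract₂_η6_proj_swap φ i j
  simp only [Pi.smul_apply, Pi.sub_apply, smul_eq_mul] at hk hi'
  field_simp
  have hii : contract₂ φ (LinearMap.proj i) η6 i = 0 := by linear_combination hii / 2
  have : c = contract₂ φ (LinearMap.proj j) η6 i := by
    apply mul_right_cancel₀ hi
    linear_combination hi' - e j * hii
  subst this
  linear_combination -hk + e k * hij

theorem coords_of_contract₂_eq_wedge {e w : V8} {φ : Module.Dual ℂ V8}
    (h : ∀ j k, contract₂ φ (LinearMap.proj j) η6 k = e j * w k - e k * w j) :
    φ (v 1) = 0 ∧ φ (v 3) = 0 ∧ φ (v 4) = 0 ∧ φ (v 5) = 0 ∧ φ (v 6) = 0 ∧ φ (v 7) = 0 ∧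
      φ (v 0) * φ (v 2) = 0 := by
  have plucker (i j k l : Fin 8) :
      contract₂ φ (LinearMap.proj i) η6 j * contract₂ φ (LinearMap.proj k) η6 l -
      contract₂ φ (LinearMap.proj i) η6 k * contract₂ φ (LinearMap.proj j) η6 l +
      contract₂ φ (LinearMap.proj i) η6 l * contract₂ φ (LinearMap.proj j) η6 k = 0 := by
    simp only [h]
    ring
  simp only [contract₂_η6] at plucker
  have h4 := plucker 2 3 5 7
  have h7 := plucker 1 2 4 5
  have h6 := plucker 0 1 3 4
  have h3 := plucker 0 4 5 6
  have h5 := plucker 1 3 4 7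
  have h1 := plucker 4 5 6 7
  have h02 := plucker 3 4 6 7
  clear plucker
  simp [v_apply] at h4 h7 h6 h3 h5 h1 h02
  simp_all

theorem coords_of_v4_v7_mem {U : Submodule ℂ V8} (hU : Module.finrank ℂ U = 4)
    (h4 : v 4 ∈ U) (h7 : v 7 ∈ U) {ψ : Module.Dual ℂ V8}
    (h : ∀ β, contract₂ ψ β η6 ∈ U) :
    ψ (v 3) = 0 ∧ ψ (v 4) = 0 ∧ ψ (v 6) = 0 ∧ ψ (v 7) = 0 ∧
      ψ (v 0) * ψ (v 1) = 0 ∧ ψ (v 0) * ψ (v 5) = 0 := by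
  have key (a b c i j k : Fin 8) (hi : i ≠ 4 ∧ i ≠ 7) (hj : j ≠ 4 ∧ j ≠ 7)
      (hk : k ≠ 4 ∧ k ≠ 7) :=
    minor_eq_zero hU (by decide) h4 h7 (h (LinearMap.proj a)) (h (LinearMap.proj b))
      (h (LinearMap.proj c)) hi hj hk
  simp only [contract₂_η6] at key
  have e4 := key 5 7 1 3 2 6 (by decide) (by decide) (by decide)
  have e6 := key 0 3 4 3 0 1 (by decide) (by decide) (by decide)
  have e7 := key 1 5 4 5 1 2 (by decide) (by decide) (by decide)
  have e3 := key 0 6 4 6 0 5 (by decide) (by decide) (by decide)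
  have e1 := key 3 6 7 6 3 5 (by decide) (by decide) (by decide)
  have e5 := key 3 6 7 6 3 1 (by decide) (by decide) (by decide)
  clear key h
  simp [v_apply] at e4 e6 e7 e3 e1 e5
  grind

theorem coords_of_v3_v6_mem {U : Submodule ℂ V8} (hU : Module.finrank ℂ U = 4)
    (h3 : v 3 ∈ U) (h6 : v 6 ∈ U) {ψ : Module.Dual ℂ V8}
    (h : ∀ β, contract₂ ψ β η6 ∈ U) :
    ψ (v 1) = 0 ∧ ψ (v 3) = 0 ∧ ψ (v 4) = 0 ∧ ψ (v 5) = 0 ∧ ψ (v 6) = 0 ∧ ψ (v 7) = 0 := by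
  have key (a b c i j k : Fin 8) (hi : i ≠ 3 ∧ i ≠ 6) (hj : j ≠ 3 ∧ j ≠ 6)
      (hk : k ≠ 3 ∧ k ≠ 6) :=
    minor_eq_zero hU (by decide) h3 h6 (h (LinearMap.proj a)) (h (LinearMap.proj b))
      (h (LinearMap.proj c)) hi hj hk
  simp only [contract₂_η6] at key
  have e4 := key 2 3 7 7 5 2 (by decide) (by decide) (by decide)
  have e6 := key 1 3 4 4 0 1 (by decide) (by decide) (by decide)
  have e7 := key 2 1 4 4 5 2 (by decide) (by decide) (by decide)
  have e3 := key 4 5 6 5 4 0 (by decide) (by decide) (by decide)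
  have e5 := key 1 3 7 7 4 1 (by decide) (by decide) (by decide)
  have e1 := key 5 6 7 7 4 5 (by decide) (by decide) (by decide)
  clear key h
  simp [v_apply] at e4 e6 e7 e3 e1 e5
  grind

/-- The fibre over the flag `U₁ ⊆ U₃ ⊆ U₄ ⊆ U₆ ⊆ U₇` of the bundle that desingularizes `Y₆`. -/
def flagFiber (U₁ U₃ U₄ U₆ U₇ : Submodule ℂ V8) : Submodule ℂ (ExteriorAlgebra ℂ V8) :=
  wSpan U₁ U₄ ⊤ ⊔ wSpan U₁ U₆ U₆ ⊔ wSpan U₃ U₃ U₇ ⊔ wSpan U₃ U₄ U₆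

section Flag

variable {U₁ U₃ U₄ U₆ U₇ : Submodule ℂ V8} {x : ExteriorAlgebra ℂ V8} {α β : Module.Dual ℂ V8}

theorem contract₂_mem_of_mem_flagFiber {p : Submodule ℂ V8} (hx : x ∈ flagFiber U₁ U₃ U₄ U₆ U₇)
    (h₁ : wSpan U₁ U₄ ⊤ ≤ p.comap (contract₂ α β)) (h₂ : wSpan U₁ U₆ U₆ ≤ p.comap (contract₂ α β))
    (h₃ : wSpan U₃ U₃ U₇ ≤ p.comap (contract₂ α β))
    (h₄ : wSpan U₃ U₄ U₆ ≤ p.comap (contract₂ α β)) : contract₂ α β x ∈ p :=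
  sup_le (sup_le (sup_le h₁ h₂) h₃) h₄ hx

theorem contract₂_mem_line (h13 : U₁ ≤ U₃) (h34 : U₃ ≤ U₄) (h46 : U₄ ≤ U₆) (h67 : U₆ ≤ U₇)
    (hx : x ∈ flagFiber U₁ U₃ U₄ U₆ U₇)
    (hα : ∀ y ∈ U₇, α y = 0) (hβ : ∀ y ∈ U₁, β y = 0) :
    contract₂ α β x ∈ U₁ := by
  refine contract₂_mem_of_mem_flagFiber hx ?_ ?_ ?_ ?_ <;>
    refine contract₂_mem_of_mem fun s hs t ht u hu ↦ ?_
  · simpa [hα s (h67 (h46 (h34 (h13 hs)))), hα t (h67 (h46 ht)), hβ s hs] using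
      U₁.smul_mem _ hs
  · simp [hα s (h67 (h46 (h34 (h13 hs)))), hα t (h67 ht), hα u (h67 hu)]
  · simp [hα s (h67 (h46 (h34 hs))), hα t (h67 (h46 (h34 ht))), hα u hu]
  · simp [hα s (h67 (h46 (h34 hs))), hα t (h67 (h46 ht)), hα u (h67 hu)]

theorem contract₂_mem_four (h13 : U₁ ≤ U₃) (h34 : U₃ ≤ U₄) (h46 : U₄ ≤ U₆)
    (hx : x ∈ flagFiber U₁ U₃ U₄ U₆ U₇)
    (hα : ∀ y ∈ U₆, α y = 0) : contract₂ α β x ∈ U₄ := by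
  refine contract₂_mem_of_mem_flagFiber hx ?_ ?_ ?_ ?_ <;>
    refine contract₂_mem_of_mem fun s hs t ht u hu ↦ ?_
  · rw [hα s (h46 (h34 (h13 hs))), hα t (h46 ht)]
    exact U₄.add_mem (U₄.add_mem (by simp) (U₄.smul_mem _ (h34 (h13 hs)))) (U₄.smul_mem _ ht)
  · simp [hα s (h46 (h34 (h13 hs))), hα t ht, hα u hu]
  · rw [hα s (h46 (h34 hs)), hα t (h46 (h34 ht))]
    exact U₄.add_mem (U₄.add_mem (by simp) (U₄.smul_mem _ (h34 hs))) (U₄.smul_mem _ (h34 ht))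
  · simp [hα s (h46 (h34 hs)), hα t (h46 ht), hα u hu]

theorem contract₂_mem_three (h13 : U₁ ≤ U₃) (h34 : U₃ ≤ U₄) (h46 : U₄ ≤ U₆)
    (hx : x ∈ flagFiber U₁ U₃ U₄ U₆ U₇)
    (hα : ∀ y ∈ U₆, α y = 0) (hβ : ∀ y ∈ U₁, β y = 0) :
    contract₂ α β x ∈ U₃ := by
  refine contract₂_mem_of_mem_flagFiber hx ?_ ?_ ?_ ?_ <;>
    refine contract₂_mem_of_mem fun s hs t ht u hu ↦ ?_
  · simpa [hα s (h46 (h34 (h13 hs))), hα t (h46 ht), hβ s hs] using U₃.smul_mem _ (h13 hs)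
  · simp [hα s (h46 (h34 (h13 hs))), hα t ht, hα u hu]
  · rw [hα s (h46 (h34 hs)), hα t (h46 (h34 ht))]
    exact U₃.add_mem (U₃.add_mem (by simp) (U₃.smul_mem _ hs)) (U₃.smul_mem _ ht)
  · simp [hα s (h46 (h34 hs)), hα t (h46 ht), hα u hu]

theorem contract₂_mem_line_of_forall_four (h13 : U₁ ≤ U₃) (h34 : U₃ ≤ U₄)
    (hx : x ∈ flagFiber U₁ U₃ U₄ U₆ U₇)
    (hα : ∀ y ∈ U₄, α y = 0) (hβ : ∀ y ∈ U₄, β y = 0) :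
    contract₂ α β x ∈ U₁ := by
  refine contract₂_mem_of_mem_flagFiber hx ?_ ?_ ?_ ?_ <;>
    refine contract₂_mem_of_mem fun s hs t ht u hu ↦ ?_
  · simp [hα s (h34 (h13 hs)), hα t ht, hβ s (h34 (h13 hs)), hβ t ht]
  · rw [hα s (h34 (h13 hs)), hβ s (h34 (h13 hs))]
    simpa using U₁.smul_mem _ hs
  · simp [hα s (h34 hs), hα t (h34 ht), hβ s (h34 hs), hβ t (h34 ht)]
  · simp [hα s (h34 hs), hα t ht, hβ s (h34 hs), hβ t ht]

/-- The flag has dimensions `1, 3, 4, 6, 7`, and `η₆` lies in the fibre over it. -/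
structure IsAdaptedFlag (U₁ U₃ U₄ U₆ U₇ : Submodule ℂ V8) : Prop where
  finrank_one : Module.finrank ℂ U₁ = 1
  finrank_three : Module.finrank ℂ U₃ = 3
  finrank_four : Module.finrank ℂ U₄ = 4
  finrank_six : Module.finrank ℂ U₆ = 6
  finrank_seven : Module.finrank ℂ U₇ = 7
  le_three : U₁ ≤ U₃
  le_four : U₃ ≤ U₄
  le_six : U₄ ≤ U₆
  le_seven : U₆ ≤ U₇
  mem : η6 ∈ flagFiber U₁ U₃ U₄ U₆ U₇

namespace IsAdaptedFlag

theorem exists_generator (F : IsAdaptedFlag U₁ U₃ U₄ U₆ U₇) :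
    ∃ e ≠ 0, U₁ = Submodule.span ℂ {e} := by
  obtain ⟨⟨e, he⟩, h0, h⟩ := finrank_eq_one_iff'.mp F.finrank_one
  refine ⟨e, fun h ↦ h0 (Subtype.ext h), le_antisymm (fun y hy ↦ ?_) ?_⟩
  · obtain ⟨c, hc⟩ := h ⟨y, hy⟩
    exact Submodule.mem_span_singleton.mpr ⟨c, congrArg Subtype.val hc⟩
  · simpa using he

theorem exists_wedge (F : IsAdaptedFlag U₁ U₃ U₄ U₆ U₇)
    {φ : Module.Dual ℂ V8} (hφ : ∀ y ∈ U₇, φ y = 0) :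
    ∃ e ≠ 0, U₁ = Submodule.span ℂ {e} ∧
      ∃ w : V8, ∀ j k, contract₂ φ (LinearMap.proj j) η6 k = e j * w k - e k * w j := by
  obtain ⟨e, he, rfl⟩ := F.exists_generator
  refine ⟨e, he, rfl, exists_wedge_of_contract₂_mem he fun β hβ ↦
    contract₂_mem_line F.le_three F.le_four F.le_six F.le_seven F.mem hφ fun y hy ↦ ?_⟩
  obtain ⟨c, rfl⟩ := Submodule.mem_span_singleton.mp hy
  simp [hβ]

theorem exists_dual_seven (F : IsAdaptedFlag U₁ U₃ U₄ U₆ U₇) :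
    ∃ φ : Module.Dual ℂ V8, φ ≠ 0 ∧ ∀ y ∈ U₇, φ y = 0 := by
  refine U₇.exists_le_ker_of_lt_top (lt_top_iff_ne_top.mpr ?_)
  rintro rfl
  simpa using F.finrank_seven

theorem exists_dual_six (F : IsAdaptedFlag U₁ U₃ U₄ U₆ U₇)
    {φ : Module.Dual ℂ V8} (hφ : ∀ y ∈ U₇, φ y = 0) {i : Fin 8}
    (hi : φ (v i) ≠ 0) :
    ∃ ψ : Module.Dual ℂ V8, ψ ≠ 0 ∧ ψ (v i) = 0 ∧ ∀ y ∈ U₆, ψ y = 0 := by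
  have hlt : U₆ < U₇ := F.le_seven.lt_of_ne fun h ↦ by
    have := F.finrank_seven
    rw [← h, F.finrank_six] at this
    omega
  obtain ⟨y, hy7, hy6⟩ := SetLike.exists_of_lt hlt
  obtain ⟨ψ, hψy, hψ⟩ := Submodule.exists_le_ker_of_notMem hy6
  refine ⟨ψ - (ψ (v i) / φ (v i)) • φ, fun h ↦ hψy ?_, by simp [hi], fun z hz ↦ ?_⟩
  · simpa [hφ y hy7] using LinearMap.congr_fun h y
  · simpa [hφ z (F.le_seven hz)] using hψ hz

end IsAdaptedFlag

theorem dual_apply_eq_sum (φ : Module.Dual ℂ V8) (y : V8) : φ y = ∑ i, y i * φ (v i) := by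
  rw [LinearMap.pi_apply_eq_sum_univ φ y]
  refine Finset.sum_congr rfl fun i _ ↦ ?_
  congr 2
  ext j
  simp [v_apply, eq_comm]

theorem apply_ne_zero_and_coord_eq_zero {U : Submodule ℂ V8} {φ : Module.Dual ℂ V8} (hφ0 : φ ≠ 0)
    (hφ : ∀ y ∈ U, φ y = 0) {i : Fin 8} (h : ∀ j ≠ i, φ (v j) = 0) :
    φ (v i) ≠ 0 ∧ ∀ y ∈ U, y i = 0 := by
  have key (y : V8) : φ y = y i * φ (v i) := by
    rw [dual_apply_eq_sum, Finset.sum_eq_single i (fun j _ hj ↦ by simp [h j hj]) (by simp)]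
  have hi : φ (v i) ≠ 0 := fun hi ↦
    hφ0 (LinearMap.ext fun y ↦ by rw [key, hi, mul_zero, LinearMap.zero_apply])
  exact ⟨hi, fun y hy ↦ by simpa [hi] using (key y).symm.trans (hφ y hy)⟩

theorem contract₂_proj_zero (β : Module.Dual ℂ V8) :
    contract₂ (LinearMap.proj 0) β η6 = β (v 3) • v 6 - β (v 6) • v 3 := by
  rw [contract₂_η6]
  ext i
  fin_cases i <;> simp [v_apply]

theorem contract₂_proj_two (β : Module.Dual ℂ V8) :
    contract₂ (LinearMap.proj 2) β η6 = β (v 4) • v 7 - β (v 7) • v 4 := by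
  rw [contract₂_η6]
  ext i
  fin_cases i <;> simp [v_apply]

theorem contract₂_proj_one_five :
    contract₂ (LinearMap.proj 1) (LinearMap.proj 5) η6 = v 7 := by
  rw [contract₂_η6]
  ext i
  fin_cases i <;> simp [v_apply]

namespace IsAdaptedFlag

theorem v7_mem_one (F : IsAdaptedFlag U₁ U₃ U₄ U₆ U₇)
    (h : U₄ = Submodule.span ℂ (v '' ({3, 4, 6, 7} : Finset (Fin 8)))) :
    v 7 ∈ U₁ := by
  rw [← contract₂_proj_one_five]
  refine contract₂_mem_line_of_forall_four F.le_three F.le_four F.mem ?_ ?_ <;>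
    exact fun y hy ↦ apply_eq_zero_of_mem_span_v_image (h ▸ hy) (by decide)

theorem four_eq (F : IsAdaptedFlag U₁ U₃ U₄ U₆ U₇)
    (h3 : v 3 ∈ U₄) (h4 : v 4 ∈ U₄) (h6 : v 6 ∈ U₄) (h7 : v 7 ∈ U₄) :
    U₄ = Submodule.span ℂ (v '' ({3, 4, 6, 7} : Finset (Fin 8))) := by
  refine (Submodule.eq_of_le_of_finrank_eq (span_v_le_of_forall.mpr ?_) ?_).symm
  · simp [h3, h4, h6, h7]
  · rw [finrank_span_v_image, F.finrank_four]
    rfl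

theorem v4_v7_mem_four (F : IsAdaptedFlag U₁ U₃ U₄ U₆ U₇) (h : ∀ y ∈ U₆, y 2 = 0) :
    v 4 ∈ U₄ ∧ v 7 ∈ U₄ := by
  have key (β) := contract₂_mem_four F.le_three F.le_four F.le_six F.mem
    (α := LinearMap.proj 2) (β := β) h
  simp only [contract₂_proj_two] at key
  exact ⟨by simpa [v_apply] using key (LinearMap.proj 7),
    by simpa [v_apply] using key (LinearMap.proj 4)⟩

theorem v3_v6_mem_four (F : IsAdaptedFlag U₁ U₃ U₄ U₆ U₇) (h : ∀ y ∈ U₆, y 0 = 0) :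
    v 3 ∈ U₄ ∧ v 6 ∈ U₄ := by
  have key (β) := contract₂_mem_four F.le_three F.le_four F.le_six F.mem
    (α := LinearMap.proj 0) (β := β) h
  simp only [contract₂_proj_zero] at key
  exact ⟨by simpa [v_apply] using key (LinearMap.proj 6),
    by simpa [v_apply] using key (LinearMap.proj 3)⟩

theorem exists_coord_seven_ne_zero (F : IsAdaptedFlag U₁ U₃ U₄ U₆ U₇) :
    ∃ y ∈ U₇, y 0 ≠ 0 := by
  by_contra! h
  obtain ⟨e, he, hU, w, hw⟩ := F.exists_wedge (φ := LinearMap.proj 0) h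
  have he7 : e 7 = 0 := by
    have h : e 7 * contract₂ (LinearMap.proj 0) (LinearMap.proj 3) η6 6 -
        e 3 * contract₂ (LinearMap.proj 0) (LinearMap.proj 7) η6 6 +
        e 6 * contract₂ (LinearMap.proj 0) (LinearMap.proj 7) η6 3 = 0 := by
      simp only [hw]
      ring
    simpa [contract₂_proj_zero, v_apply] using h
  obtain ⟨h3, h6⟩ := F.v3_v6_mem_four fun y hy ↦ h y (F.le_seven hy)
  obtain ⟨ψ, hψ0, b0, hψ⟩ := F.exists_dual_six (φ := LinearMap.proj 0) h (i := 0)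
    (by simp [v_apply])
  obtain ⟨b1, b3, b4, b5, b6, b7⟩ := coords_of_v3_v6_mem F.finrank_four h3 h6 fun β ↦
    contract₂_mem_four F.le_three F.le_four F.le_six F.mem hψ
  obtain ⟨-, h2⟩ := apply_ne_zero_and_coord_eq_zero (i := 2) hψ0 hψ
    (fun j hj ↦ by fin_cases j <;> first | assumption | exact absurd rfl hj)
  obtain ⟨h4, h7⟩ := F.v4_v7_mem_four h2
  have := F.v7_mem_one (F.four_eq h3 h4 h6 h7)
  rw [hU] at this
  obtain ⟨c, hc⟩ := Submodule.mem_span_singleton.mp this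
  simpa [v_apply, he7] using congrFun hc 7

theorem coord_seven_eq_zero (F : IsAdaptedFlag U₁ U₃ U₄ U₆ U₇) : ∀ y ∈ U₇, y 2 = 0 := by
  obtain ⟨φ, hφ0, hφ⟩ := F.exists_dual_seven
  obtain ⟨e, he, hU, w, hw⟩ := F.exists_wedge hφ
  obtain ⟨a1, a3, a4, a5, a6, a7, a02⟩ := coords_of_contract₂_eq_wedge hw
  rcases mul_eq_zero.mp a02 with a | a
  · exact (apply_ne_zero_and_coord_eq_zero hφ0 hφ
      (fun j hj ↦ by fin_cases j <;> first | assumption | exact absurd rfl hj)).2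
  · obtain ⟨y, hy, hy0⟩ := F.exists_coord_seven_ne_zero
    exact absurd ((apply_ne_zero_and_coord_eq_zero (i := 0) hφ0 hφ
      (fun j hj ↦ by fin_cases j <;> first | assumption | exact absurd rfl hj)).2 y hy) hy0

theorem coord_one_eq_zero (F : IsAdaptedFlag U₁ U₃ U₄ U₆ U₇) {y : V8} (hy : y ∈ U₁) {j : Fin 8}
    (hj : j ≠ 4 ∧ j ≠ 7) : y j = 0 := by
  obtain ⟨e, he, rfl, w, hw⟩ := F.exists_wedge (φ := LinearMap.proj 2) F.coord_seven_eq_zero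
  have hej : e j = 0 := by
    have h : e j * contract₂ (LinearMap.proj 2) (LinearMap.proj 4) η6 7 -
        e 4 * contract₂ (LinearMap.proj 2) (LinearMap.proj j) η6 7 +
        e 7 * contract₂ (LinearMap.proj 2) (LinearMap.proj j) η6 4 = 0 := by
      simp only [hw]
      ring
    simpa [contract₂_proj_two, v_apply, hj] using h
  obtain ⟨c, rfl⟩ := Submodule.mem_span_singleton.mp hy
  simp [hej]

theorem coord_six_eq_zero (F : IsAdaptedFlag U₁ U₃ U₄ U₆ U₇) : ∀ y ∈ U₆, y 0 = 0 := by
  have h2 := F.coord_seven_eq_zero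
  obtain ⟨h4, h7⟩ := F.v4_v7_mem_four fun y hy ↦ h2 y (F.le_seven hy)
  obtain ⟨ψ, hψ0, b2, hψ⟩ := F.exists_dual_six (φ := LinearMap.proj 2) h2 (i := 2)
    (by simp [v_apply])
  have hψ4 (β) : contract₂ ψ β η6 ∈ U₄ :=
    contract₂_mem_four F.le_three F.le_four F.le_six F.mem hψ
  obtain ⟨b3, b4, b6, b7, b01, b05⟩ := coords_of_v4_v7_mem F.finrank_four h4 h7 hψ4
  by_cases b0 : ψ (v 0) = 0
  · have key {y : V8} (hy : y ∈ U₄) (i j k : Fin 8) (hi : i ≠ 4 ∧ i ≠ 7) (hj : j ≠ 4 ∧ j ≠ 7)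
        (hk : k ≠ 4 ∧ k ≠ 7) :=
      minor_eq_zero F.finrank_four (by decide) h4 h7 (hψ4 (LinearMap.proj 4))
        (hψ4 (LinearMap.proj 7)) hy hi hj hk
    have hne : ψ (v 1) ≠ 0 ∨ ψ (v 5) ≠ 0 := by
      by_contra! h
      exact (apply_ne_zero_and_coord_eq_zero (i := 1) hψ0 hψ
        (fun j hj ↦ by fin_cases j <;> first | assumption | exact h.2 | exact absurd rfl hj)).1 h.1
    have hker {y : V8} (hy : y ∈ U₄) : y 0 = 0 ∧ ψ (v 1) * y 3 + ψ (v 5) * y 6 = 0 := by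
      have k1 := key hy 6 5 0 (by decide) (by decide) (by decide)
      have k2 := key hy 6 5 3 (by decide) (by decide) (by decide)
      have k3 := key hy 3 1 0 (by decide) (by decide) (by decide)
      have k4 := key hy 3 1 6 (by decide) (by decide) (by decide)
      simp [contract₂_η6, v_apply, b0, b2, b3, b4, b6, b7] at k1 k2 k3 k4
      clear key
      grind
    have hmem := contract₂_mem_line_of_forall_four F.le_three F.le_four F.mem
      (α := LinearMap.proj 0) (β := ψ (v 1) • LinearMap.proj 3 + ψ (v 5) • LinearMap.proj 6)
      (fun y hy ↦ (hker hy).1) (fun y hy ↦ by simpa using (hker hy).2)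
    have h3 := F.coord_one_eq_zero hmem (j := 3) (by decide)
    have h6 := F.coord_one_eq_zero hmem (j := 6) (by decide)
    simp [contract₂_proj_zero, v_apply] at h3 h6
    tauto
  · have b1 : ψ (v 1) = 0 := by simpa [b0] using b01
    have b5 : ψ (v 5) = 0 := by simpa [b0] using b05
    exact (apply_ne_zero_and_coord_eq_zero hψ0 hψ
      (fun j hj ↦ by fin_cases j <;> first | assumption | exact absurd rfl hj)).2

theorem eq_span (F : IsAdaptedFlag U₁ U₃ U₄ U₆ U₇) :
    U₁ = Submodule.span ℂ (v '' ({7} : Finset (Fin 8))) ∧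
    U₃ = Submodule.span ℂ (v '' ({3, 6, 7} : Finset (Fin 8))) ∧
    U₄ = Submodule.span ℂ (v '' ({3, 4, 6, 7} : Finset (Fin 8))) ∧
    U₆ = Submodule.span ℂ (v '' ({1, 3, 4, 5, 6, 7} : Finset (Fin 8))) ∧
    U₇ = Submodule.span ℂ (v '' ({0, 1, 3, 4, 5, 6, 7} : Finset (Fin 8))) := by
  have hy2 := F.coord_seven_eq_zero
  have hy0 := F.coord_six_eq_zero
  obtain ⟨h4, h7⟩ := F.v4_v7_mem_four fun y hy ↦ hy2 y (F.le_seven hy)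
  obtain ⟨h3, h6⟩ := F.v3_v6_mem_four hy0
  have hU4 := F.four_eq h3 h4 h6 h7
  have hU1 : U₁ = Submodule.span ℂ (v '' ({7} : Finset (Fin 8))) := by
    refine (Submodule.eq_of_le_of_finrank_eq (span_v_le_of_forall.mpr ?_) ?_).symm
    · simpa using F.v7_mem_one hU4
    · rw [finrank_span_v_image, F.finrank_one]
      rfl
  have hmem (i : Fin 8) (hi : i ≠ 7) :=
    contract₂_mem_three F.le_three F.le_four F.le_six F.mem
      (α := LinearMap.proj 0) (β := LinearMap.proj i) hy0
      fun y hy ↦ apply_eq_zero_of_mem_span_v_image (hU1 ▸ hy) (by simpa using hi)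
  simp only [contract₂_proj_zero] at hmem
  have h33 : v 3 ∈ U₃ := by simpa [v_apply] using hmem 6 (by decide)
  have h63 : v 6 ∈ U₃ := by simpa [v_apply] using hmem 3 (by decide)
  refine ⟨hU1, ?_, hU4, ?_, ?_⟩
  · refine (Submodule.eq_of_le_of_finrank_eq (span_v_le_of_forall.mpr ?_) ?_).symm
    · simp [h33, h63, F.le_three (F.v7_mem_one hU4)]
    · rw [finrank_span_v_image, F.finrank_three]
      rfl
  · refine Submodule.eq_of_le_of_finrank_eq (fun y hy ↦ mem_span_v_image fun i hi ↦ ?_) ?_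
    · fin_cases i <;> first | exact hy0 y hy | exact hy2 y (F.le_seven hy) | simp at hi
    · rw [finrank_span_v_image, F.finrank_six]
      rfl
  · refine Submodule.eq_of_le_of_finrank_eq (fun y hy ↦ mem_span_v_image fun i hi ↦ ?_) ?_
    · fin_cases i <;> first | exact hy2 y hy | simp at hi
    · rw [finrank_span_v_image, F.finrank_seven]
      rfl

end IsAdaptedFlag

end Flag

theorem ι_mul_mem_wSpan {S T U : Submodule ℂ V8} {s t u : V8} (hs : s ∈ S) (ht : t ∈ T)
    (hu : u ∈ U) : ι ℂ s * ι ℂ t * ι ℂ u ∈ wSpan S T U :=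
  Submodule.subset_span ⟨s, hs, t, ht, u, hu, rfl⟩

theorem ι_mul_ι_swap (s t : V8) : ι ℂ s * ι ℂ t = -(ι ℂ t * ι ℂ s) :=
  eq_neg_of_add_eq_zero_left (ExteriorAlgebra.ι_add_mul_swap s t)

theorem v_mem_span_v_image {S : Set (Fin 8)} {i : Fin 8} (hi : i ∈ S) :
    v i ∈ Submodule.span ℂ (v '' S) :=
  Submodule.subset_span ⟨i, hi, rfl⟩

theorem isAdaptedFlag_span_v :
    IsAdaptedFlag (Submodule.span ℂ (v '' ({7} : Finset (Fin 8))))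
      (Submodule.span ℂ (v '' ({3, 6, 7} : Finset (Fin 8))))
      (Submodule.span ℂ (v '' ({3, 4, 6, 7} : Finset (Fin 8))))
      (Submodule.span ℂ (v '' ({1, 3, 4, 5, 6, 7} : Finset (Fin 8))))
      (Submodule.span ℂ (v '' ({0, 1, 3, 4, 5, 6, 7} : Finset (Fin 8)))) where
  finrank_one := finrank_span_v_image _
  finrank_three := finrank_span_v_image _
  finrank_four := finrank_span_v_image _
  finrank_six := finrank_span_v_image _
  finrank_seven := finrank_span_v_image _
  le_three := Submodule.span_mono (Set.image_mono (Finset.coe_subset.mpr (by decide)))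
  le_four := Submodule.span_mono (Set.image_mono (Finset.coe_subset.mpr (by decide)))
  le_six := Submodule.span_mono (Set.image_mono (Finset.coe_subset.mpr (by decide)))
  le_seven := Submodule.span_mono (Set.image_mono (Finset.coe_subset.mpr (by decide)))
  mem := by
    have h036 : ι ℂ (v 0) * ι ℂ (v 3) * ι ℂ (v 6) = ι ℂ (v 3) * ι ℂ (v 6) * ι ℂ (v 0) := by
      rw [ι_mul_ι_swap (v 0), neg_mul, mul_assoc, ι_mul_ι_swap (v 0), mul_neg, neg_neg, mul_assoc]
    have h146 : ι ℂ (v 1) * ι ℂ (v 4) * ι ℂ (v 6) = -(ι ℂ (v 6) * ι ℂ (v 4) * ι ℂ (v 1)) := by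
      rw [mul_assoc, ι_mul_ι_swap (v 4), mul_neg, ← mul_assoc, ι_mul_ι_swap (v 1), neg_mul, neg_neg,
        mul_assoc, ι_mul_ι_swap (v 1), mul_neg, mul_assoc]
    have h7 (i j : Fin 8) :
        ι ℂ (v i) * ι ℂ (v j) * ι ℂ (v 7) = ι ℂ (v 7) * ι ℂ (v i) * ι ℂ (v j) := by
      rw [mul_assoc, ι_mul_ι_swap (v j), mul_neg, ← mul_assoc, ι_mul_ι_swap (v i), neg_mul, neg_neg]
    have h247 : ι ℂ (v 2) * ι ℂ (v 4) * ι ℂ (v 7) = -(ι ℂ (v 7) * ι ℂ (v 4) * ι ℂ (v 2)) := by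
      rw [h7, mul_assoc, ι_mul_ι_swap (v 2), mul_neg, mul_assoc]
    rw [η6, h036, h146, h7 1 5, h247]
    refine add_mem (add_mem (add_mem (add_mem ?_ ?_) (neg_mem ?_)) ?_) (neg_mem ?_)
    · exact Submodule.mem_sup_right (ι_mul_mem_wSpan (v_mem_span_v_image (by simp))
        (v_mem_span_v_image (by simp)) (v_mem_span_v_image (by simp)))
    · exact Submodule.mem_sup_left (Submodule.mem_sup_right (ι_mul_mem_wSpan
        (v_mem_span_v_image (by simp)) (v_mem_span_v_image (by simp))
        (v_mem_span_v_image (by simp))))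
    · exact Submodule.mem_sup_right (ι_mul_mem_wSpan (v_mem_span_v_image (by simp))
        (v_mem_span_v_image (by simp)) (v_mem_span_v_image (by simp)))
    · exact Submodule.mem_sup_left (Submodule.mem_sup_left (Submodule.mem_sup_right
        (ι_mul_mem_wSpan (v_mem_span_v_image (by simp)) (v_mem_span_v_image (by simp))
          (v_mem_span_v_image (by simp)))))
    · exact Submodule.mem_sup_left (Submodule.mem_sup_left (Submodule.mem_sup_left
        (ι_mul_mem_wSpan (v_mem_span_v_image (by simp)) (v_mem_span_v_image (by simp))
          Submodule.mem_top)))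

theorem unique_flag_over_η6 :
    {F : Submodule ℂ V8 × Submodule ℂ V8 × Submodule ℂ V8 × Submodule ℂ V8 × Submodule ℂ V8 |
      Module.finrank ℂ F.1 = 1 ∧ Module.finrank ℂ F.2.1 = 3 ∧
      Module.finrank ℂ F.2.2.1 = 4 ∧ Module.finrank ℂ F.2.2.2.1 = 6 ∧
      Module.finrank ℂ F.2.2.2.2 = 7 ∧
      F.1 ≤ F.2.1 ∧ F.2.1 ≤ F.2.2.1 ∧ F.2.2.1 ≤ F.2.2.2.1 ∧ F.2.2.2.1 ≤ F.2.2.2.2 ∧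
      η6 ∈ wSpan F.1 F.2.2.1 ⊤ ⊔ wSpan F.1 F.2.2.2.1 F.2.2.2.1 ⊔
            wSpan F.2.1 F.2.1 F.2.2.2.2 ⊔ wSpan F.2.1 F.2.2.1 F.2.2.2.1} =
    {(Submodule.span ℂ {v 7},
      Submodule.span ℂ {v 3, v 6, v 7},
      Submodule.span ℂ {v 3, v 4, v 6, v 7},
      Submodule.span ℂ {v 1, v 3, v 4, v 5, v 6, v 7},
      Submodule.span ℂ {v 0, v 1, v 3, v 4, v 5, v 6, v 7})} := by
  ext ⟨U₁, U₃, U₄, U₆, U₇⟩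
  have hspan := isAdaptedFlag_span_v
  have heq := @IsAdaptedFlag.eq_span U₁ U₃ U₄ U₆ U₇
  simp only [Finset.coe_insert, Finset.coe_singleton, Set.image_insert_eq,
    Set.image_singleton] at hspan heq
  simp only [Set.mem_ofPred_eq, Set.mem_singleton_iff, Prod.mk.injEq]
  constructor
  · rintro ⟨h1, h3, h4, h6, h7, h13, h34, h46, h67, h⟩
    exact heq ⟨h1, h3, h4, h6, h7, h13, h34, h46, h67, h⟩
  · rintro ⟨rfl, rfl, rfl, rfl, rfl⟩
    obtain ⟨h1, h3, h4, h6, h7, h13, h34, h46, h67, h⟩ := hspan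
    exact ⟨h1, h3, h4, h6, h7, h13, h34, h46, h67, h⟩
end
end

section
/- Let V₇ be a 7-dimensional complex vector space, let v₁ ∈ V₇ be nonzero, and let α ∈ ⋀²V₇. Then v₁∧α∧α = 0 in ⋀⁵V₇ if and only if there exist u, v, w ∈ V₇ such that α = v₁∧u + v∧w. -/
open ExteriorAlgebra

noncomputable section

namespace ExteriorAlgebra

section CommRing

variable {R M : Type*} [CommRing R] [AddCommGroup M] [Module R M]

/-- The interior product of a linear form with an element of the exterior algebra. -/
def interior (g : Module.Dual R M) : ExteriorAlgebra R M →ₗ[R] ExteriorAlgebra R M :=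
  CliffordAlgebra.contractLeft g

lemma interior_ι (g : Module.Dual R M) (a : M) :
    interior g (ι R a) = algebraMap R _ (g a) :=
  CliffordAlgebra.contractLeft_ι _ _ _

lemma interior_ι_mul (g : Module.Dual R M) (a : M) (x : ExteriorAlgebra R M) :
    interior g (ι R a * x) = g a • x - ι R a * interior g x :=
  CliffordAlgebra.contractLeft_ι_mul _ _ _

lemma interior_interior_self (g : Module.Dual R M) (x : ExteriorAlgebra R M) :
    interior g (interior g x) = 0 :=
  CliffordAlgebra.contractLeft_contractLeft _ _

lemma interior_ι_mul_ι (g : Module.Dual R M) (a b : M) :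
    interior g (ι R a * ι R b) = g a • ι R b - g b • ι R a := by
  rw [interior_ι_mul, interior_ι, ← Algebra.commutes, ← Algebra.smul_def]

lemma ι_mul_ι_comm (a b : M) : ι R a * ι R b = -(ι R b * ι R a) :=
  eq_neg_of_add_eq_zero_left (ι_add_mul_swap a b)

/-- Induction on elements of the second exterior power. -/
@[elab_as_elim]
lemma exteriorPower_two_induction {C : ExteriorAlgebra R M → Prop} {x : ExteriorAlgebra R M}
    (hx : x ∈ ⋀[R]^2 M) (mul : ∀ a b, C (ι R a * ι R b))
    (add : ∀ x y, C x → C y → C (x + y)) : C x := by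
  rw [exteriorPower, pow_two] at hx
  refine Submodule.mul_induction_on hx ?_ add
  rintro _ ⟨a, rfl⟩ _ ⟨b, rfl⟩
  exact mul a b

lemma ι_mul_ι_mem (a b : M) : ι R a * ι R b ∈ ⋀[R]^2 M := by
  rw [exteriorPower, pow_two]
  exact Submodule.mul_mem_mul ⟨a, rfl⟩ ⟨b, rfl⟩

lemma exists_interior_eq_ι (g : Module.Dual R M) {x : ExteriorAlgebra R M}
    (hx : x ∈ ⋀[R]^2 M) : ∃ a, interior g x = ι R a := by
  refine exteriorPower_two_induction hx (fun a b => ⟨g a • b - g b • a, ?_⟩) ?_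
  · rw [interior_ι_mul_ι, map_sub, map_smul, map_smul]
  · rintro x y ⟨a, ha⟩ ⟨b, hb⟩
    exact ⟨a + b, by rw [map_add, ha, hb, map_add]⟩

lemma mul_ι_comm {x : ExteriorAlgebra R M} (hx : x ∈ ⋀[R]^2 M) (m : M) :
    x * ι R m = ι R m * x := by
  refine exteriorPower_two_induction hx (fun a b => ?_) ?_
  · rw [mul_assoc, ι_mul_ι_comm b m, mul_neg, ← mul_assoc, ι_mul_ι_comm a m, neg_mul, neg_neg,
      mul_assoc]
  · intro x y hx hy
    rw [add_mul, mul_add, hx, hy]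

lemma interior_mul (g : Module.Dual R M) {x : ExteriorAlgebra R M} (hx : x ∈ ⋀[R]^2 M)
    (y : ExteriorAlgebra R M) :
    interior g (x * y) = interior g x * y + x * interior g y := by
  refine exteriorPower_two_induction hx (fun a b => ?_) ?_
  · rw [interior_ι_mul_ι, mul_assoc, interior_ι_mul, interior_ι_mul]
    simp only [mul_sub, sub_mul, smul_mul_assoc, mul_smul_comm, mul_assoc]
    abel
  · intro x z hx hz
    simp only [add_mul, map_add, hx, hz]
    abel

/-- Euler's identity in degree two. -/
lemma sum_ι_mul_interior {I : Type*} [Fintype I] (b : Module.Basis I R M)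
    {x : ExteriorAlgebra R M} (hx : x ∈ ⋀[R]^2 M) :
    ∑ i, ι R (b i) * interior (b.coord i) x = (2 : R) • x := by
  refine exteriorPower_two_induction hx (fun m n => ?_) ?_
  · have expand (m : M) : ∑ i, b.coord i m • ι R (b i) = ι R m := by
      simp only [← map_smul, ← map_sum, Module.Basis.coord_apply, b.sum_repr]
    simp only [interior_ι_mul_ι, mul_sub, mul_smul_comm, ← smul_mul_assoc, Finset.sum_sub_distrib,
      ← Finset.sum_mul, expand]
    rw [ι_mul_ι_comm n m, sub_neg_eq_add, two_smul, add_mul]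
  · intro x y hx hy
    simp only [map_add, mul_add, Finset.sum_add_distrib, hx, hy, smul_add]

lemma ι_mul_mul_self_eq_zero (v₁ u v w : M) :
    ι R v₁ * (ι R v₁ * ι R u + ι R v * ι R w) * (ι R v₁ * ι R u + ι R v * ι R w) = 0 := by
  have key (x : ExteriorAlgebra R M) (v w : M) : x * (ι R v * ι R w) * (ι R v * ι R w) = 0 := by
    rw [mul_assoc, ← mul_assoc (ι R v * ι R w), mul_ι_comm (ι_mul_ι_mem v w), ← mul_assoc (ι R v),
      ι_sq_zero, zero_mul, zero_mul, mul_zero]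
  have hv : ι R v₁ * (ι R v₁ * ι R u) = 0 := by rw [← mul_assoc, ι_sq_zero, zero_mul]
  rw [mul_add (ι R v₁), hv, zero_add, mul_add, key, add_zero, mul_assoc, ← mul_assoc (ι R v * ι R w),
    mul_ι_comm (ι_mul_ι_mem v w), mul_assoc (ι R v₁), ← mul_assoc (ι R v₁), ι_sq_zero, zero_mul]

end CommRing

section Field

variable {K V : Type*} [Field K] [NeZero (2 : K)] [AddCommGroup V] [Module K V]

/-- A bivector with zero square is decomposable. -/
lemma exists_eq_ι_mul_ι_of_mul_self_eq_zero [FiniteDimensional K V] {x : ExteriorAlgebra K V}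
    (hx : x ∈ ⋀[K]^2 V) (hxx : x * x = 0) : ∃ v w, x = ι K v * ι K w := by
  by_cases h0 : ∀ g : Module.Dual K V, interior g x = 0
  · have hsum := sum_ι_mul_interior (Module.finBasis K V) hx
    simp only [h0, mul_zero, Finset.sum_const_zero] at hsum
    exact ⟨0, 0, by simpa [two_ne_zero] using hsum.symm⟩
  · push Not at h0
    obtain ⟨g, hg⟩ := h0
    obtain ⟨a, ha⟩ := exists_interior_eq_ι g hx
    have ha0 : a ≠ 0 := by
      rintro rfl
      exact hg (by rw [ha, map_zero])
    have hax : ι K a * x = 0 := by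
      have h := interior_mul g hx x
      rw [hxx, map_zero, ha, mul_ι_comm hx, ← two_smul K] at h
      exact (smul_eq_zero.mp h.symm).resolve_left two_ne_zero
    obtain ⟨f, hf⟩ := Module.Projective.exists_dual_ne_zero K ha0
    obtain ⟨b, hb⟩ := exists_interior_eq_ι f hx
    have h := interior_ι_mul f a x
    rw [hax, map_zero, hb, eq_comm, sub_eq_zero] at h
    refine ⟨a, (f a)⁻¹ • b, ?_⟩
    rw [map_smul, mul_smul_comm, ← h, smul_smul, inv_mul_cancel₀ hf, one_smul]

lemma ι_mul_mul_self_eq_zero_iff [FiniteDimensional K V] {v₁ : V} (hv₁ : v₁ ≠ 0)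
    {x : ExteriorAlgebra K V} (hx : x ∈ ⋀[K]^2 V) :
    ι K v₁ * x * x = 0 ↔ ∃ u v w : V, x = ι K v₁ * ι K u + ι K v * ι K w := by
  refine ⟨fun h => ?_, ?_⟩
  · obtain ⟨f₀, hf₀⟩ := Module.Projective.exists_dual_ne_zero K hv₁
    obtain ⟨f, hf⟩ : ∃ f : Module.Dual K V, f v₁ = 1 :=
      ⟨(f₀ v₁)⁻¹ • f₀, by simp [hf₀]⟩
    obtain ⟨u, hu⟩ := exists_interior_eq_ι f hx
    have hfu : f u = 0 := by
      have h := interior_interior_self f x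
      rwa [hu, interior_ι, algebraMap_eq_zero_iff] at h
    obtain ⟨y, rfl⟩ : ∃ y, x = ι K v₁ * ι K u + y := ⟨x - ι K v₁ * ι K u, by abel⟩
    have hy : y ∈ ⋀[K]^2 V := by
      simpa using Submodule.sub_mem _ hx (ι_mul_ι_mem v₁ u)
    have hfy : interior f y = 0 := by
      simpa [interior_ι_mul_ι, hf, hfu] using hu
    have hvy : ι K v₁ * (y * y) = 0 := by
      have hv (z : ExteriorAlgebra K V) : ι K v₁ * (ι K v₁ * z) = 0 := by
        rw [← mul_assoc, ι_sq_zero, zero_mul]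
      rw [mul_add (ι K v₁), hv, zero_add, mul_add, mul_assoc, mul_assoc, ← mul_assoc y,
        mul_ι_comm hy, mul_assoc, hv, zero_add] at h
      exact h
    have hyy : y * y = 0 := by
      have h := interior_ι_mul f v₁ (y * y)
      rw [hvy, map_zero, interior_mul f hy, hfy, hf] at h
      simpa using h.symm
    obtain ⟨v, w, rfl⟩ := exists_eq_ι_mul_ι_of_mul_self_eq_zero hy hyy
    exact ⟨u, v, w, rfl⟩
  · rintro ⟨u, v, w, rfl⟩
    exact ι_mul_mul_self_eq_zero v₁ u v w

end Field

end ExteriorAlgebra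

theorem wedge_square_zero_iff (V₇ : Type*) [AddCommGroup V₇] [Module ℂ V₇]
    (hdim : Module.finrank ℂ V₇ = 7)
    (v₁ : V₇) (hv₁ : v₁ ≠ 0)
    (α : ExteriorAlgebra ℂ V₇) (hα : α ∈ ⋀[ℂ]^2 V₇) :
    ι ℂ v₁ * α * α = 0 ↔ ∃ u v w : V₇, α = ι ℂ v₁ * ι ℂ u + ι ℂ v * ι ℂ w := by
  have : FiniteDimensional ℂ V₇ := FiniteDimensional.of_finrank_pos (by omega)
  exact ι_mul_mul_self_eq_zero_iff hv₁ hα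
end
end
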